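/- arXiv:1705.06754 — 2 statements merged into one kernel-verified Lean document; each statement's English description precedes it below -/
import Mathlib

section
/- Airy squared identity: for all real y, ∫_ℝ Ai(z² − y) dz = 2^{2/3} π Ai²(−y/2^{2/3}). -/
open MeasureTheory Filter

noncomputable def airyK (x : ℝ) (w : ℂ) : ℂ :=
  Complex.exp (Complex.I * (w ^ 3 / 3 + (x : ℂ) * w))

lemma airyK_norm (x t s : ℝ) :
    ‖airyK x ((t : ℂ) + (s : ℂ) * Complex.I)‖
      = Real.exp (s ^ 3 / 3 - x * s) * Real.exp (-s * t ^ 2) := by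
  have h : Complex.I * ((((t : ℂ) + (s : ℂ) * Complex.I)) ^ 3 / 3
      + (x : ℂ) * ((t : ℂ) + (s : ℂ) * Complex.I))
      = ((s ^ 3 / 3 - x * s + -s * t ^ 2 : ℝ) : ℂ)
        + ((t ^ 3 / 3 - t * s ^ 2 + x * t : ℝ) : ℂ) * Complex.I := by
    push_cast
    have h2 : Complex.I ^ 2 = -1 := Complex.I_sq
    have h3 : Complex.I ^ 3 = -Complex.I := by rw [pow_succ, h2]; ring
    have h4 : Complex.I ^ 4 = 1 := Complex.I_pow_four
    ring_nf
    rw [h2, h3, h4]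
    ring
  rw [airyK, h, Complex.norm_exp, ← Real.exp_add, Complex.add_re, Complex.ofReal_re, Complex.re_ofReal_mul, Complex.I_re,
    mul_zero, add_zero]

lemma airyK_diff (x : ℝ) : Differentiable ℂ (airyK x) := by
  unfold airyK
  fun_prop

lemma airyK_cont (x : ℝ) : Continuous (airyK x) := (airyK_diff x).continuous

lemma airyK_integrable (x s : ℝ) (hs : 0 < s) :
    Integrable (fun t : ℝ => airyK x ((t : ℂ) + (s : ℂ) * Complex.I)) := by
  have h := (integrable_exp_neg_mul_sq hs).const_mul (Real.exp (s ^ 3 / 3 - x * s))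
  refine h.mono' ?_ (Eventually.of_forall fun t => (airyK_norm x t s).le)
  exact ((airyK_cont x).comp (by fun_prop)).aestronglyMeasurable

lemma airyK_side (x s : ℝ) (hs : 0 < s) (l : Filter ℝ) [l.IsCountablyGenerated]
    (hl : Tendsto (fun R : ℝ => R ^ 2) l atTop) :
    Tendsto (fun R : ℝ => ∫ u in (0:ℝ)..s, airyK x ((R : ℂ) + (u : ℂ) * Complex.I))
      l (nhds 0) := by
  have h0 : (0 : ℂ) = ∫ u in (0:ℝ)..s, (0 : ℂ) := by simp
  rw [h0]
  refine intervalIntegral.tendsto_integral_filter_of_dominated_convergence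
    (fun u => Real.exp (u ^ 3 / 3 - x * u)) ?_ ?_ ?_ ?_
  · exact Eventually.of_forall fun R =>
      ((airyK_cont x).comp (by fun_prop)).aestronglyMeasurable
  · refine Eventually.of_forall fun R => Eventually.of_forall fun u hu => ?_
    rw [Set.uIoc_of_le hs.le] at hu
    rw [airyK_norm]
    refine mul_le_of_le_one_right (Real.exp_pos _).le ?_
    rw [Real.exp_le_one_iff]
    nlinarith [mul_nonneg hu.1.le (sq_nonneg R)]
  · exact Continuous.intervalIntegrable (by fun_prop) _ _
  · refine Eventually.of_forall fun u hu => ?_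
    rw [Set.uIoc_of_le hs.le] at hu
    rw [tendsto_zero_iff_norm_tendsto_zero]
    simp_rw [airyK_norm]
    rw [← mul_zero (Real.exp (u ^ 3 / 3 - x * u))]
    refine Tendsto.const_mul _ (Real.tendsto_exp_atBot.comp ?_)
    exact hl.const_mul_atTop_of_neg (by linarith [hu.1])

lemma airyK_real (x R : ℝ) :
    ∫ t in (-R)..R, airyK x (t : ℂ)
      = ((2 * ∫ t in (0:ℝ)..R, Real.cos (t ^ 3 / 3 + x * t) : ℝ) : ℂ) := by
  have hc : Continuous fun t : ℝ => airyK x (t : ℂ) := (airyK_cont x).comp (by fun_prop)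
  rw [← intervalIntegral.integral_add_adjacent_intervals
    (hc.intervalIntegrable (-R) 0) (hc.intervalIntegrable 0 R)]
  have h1 : ∫ t in (-R)..0, airyK x (t : ℂ) = ∫ t in (0:ℝ)..R, airyK x ((-t : ℝ) : ℂ) := by
    rw [intervalIntegral.integral_comp_neg (fun t : ℝ => airyK x (t : ℂ))]
    simp
  have hc' : Continuous fun t : ℝ => airyK x ((-t : ℝ) : ℂ) := (airyK_cont x).comp (by fun_prop)
  rw [h1, ← intervalIntegral.integral_add (hc'.intervalIntegrable _ _)
    (hc.intervalIntegrable _ _), ← intervalIntegral.integral_const_mul,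
    ← intervalIntegral.integral_ofReal]
  congr 1
  ext t
  push_cast
  rw [Complex.two_cos, airyK, airyK, add_comm]
  congr 2 <;> ring

lemma airy_shift (A x s : ℝ) (hs : 0 < s)
    (hA : Tendsto
      (fun R : ℝ => (1 / Real.pi) * ∫ t in (0:ℝ)..R, Real.cos (t ^ 3 / 3 + x * t))
      atTop (nhds A)) :
    ∫ t : ℝ, airyK x ((t : ℂ) + (s : ℂ) * Complex.I) = ((2 * Real.pi * A : ℝ) : ℂ) := by
  have h1 : Tendsto (fun R : ℝ => ∫ t in (-R)..R, airyK x ((t : ℂ) + (s : ℂ) * Complex.I))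
      atTop (nhds (∫ t : ℝ, airyK x ((t : ℂ) + (s : ℂ) * Complex.I))) :=
    intervalIntegral_tendsto_integral (airyK_integrable x s hs) tendsto_neg_atTop_atBot tendsto_id
  have h2 : Tendsto (fun R : ℝ => ∫ t in (-R)..R, airyK x (t : ℂ))
      atTop (nhds ((2 * Real.pi * A : ℝ) : ℂ)) := by
    simp_rw [airyK_real]
    refine (Complex.continuous_ofReal.tendsto _).comp ?_
    have := hA.const_mul (2 * Real.pi)
    refine this.congr fun R => ?_
    field_simp
  have h3 := airyK_side x s hs atTop (tendsto_pow_atTop two_ne_zero)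
  have h4 := airyK_side x s hs (Filter.map (fun R : ℝ => -R) atTop) (by
    rw [tendsto_map'_iff]
    refine (tendsto_pow_atTop (α := ℝ) two_ne_zero).congr fun R => ?_
    simp)
  rw [tendsto_map'_iff] at h4
  have key : ∀ R : ℝ, ∫ t in (-R)..R, airyK x ((t : ℂ) + (s : ℂ) * Complex.I)
      = (∫ t in (-R)..R, airyK x (t : ℂ))
        + Complex.I * (∫ u in (0:ℝ)..s, airyK x ((R : ℂ) + (u : ℂ) * Complex.I))
        - Complex.I * (∫ u in (0:ℝ)..s, airyK x (((-R : ℝ) : ℂ) + (u : ℂ) * Complex.I)) := by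
    intro R
    have := Complex.integral_boundary_rect_eq_zero_of_differentiableOn (airyK x)
      ((-R : ℝ) : ℂ) ((R : ℂ) + (s : ℂ) * Complex.I) (airyK_diff x).differentiableOn
    simp only [Complex.add_re, Complex.add_im, Complex.ofReal_re, Complex.ofReal_im,
      Complex.mul_re, Complex.mul_im, Complex.I_re, Complex.I_im, mul_zero, mul_one,
      zero_add, add_zero, sub_zero, Complex.ofReal_zero, zero_mul, smul_eq_mul] at this
    linear_combination -this
  have h5 := (h2.add (h3.const_mul Complex.I)).sub (h4.const_mul Complex.I)
  refine tendsto_nhds_unique h1 ?_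
  have h6 := h5.congr fun R => (key R).symm
  simpa using h6

lemma airy_prod_integrable (y : ℝ) :
    Integrable (Function.uncurry fun z t : ℝ =>
      airyK (z ^ 2 - y) ((t : ℂ) + ((1 : ℝ) : ℂ) * Complex.I))
      ((volume : Measure ℝ).prod volume) := by
  have h := ((integrable_exp_neg_mul_sq one_pos).const_mul
    (Real.exp (1 / 3 + y))).mul_prod (integrable_exp_neg_mul_sq one_pos)
  refine h.mono' ?_ (Eventually.of_forall fun p => ?_)
  · refine Continuous.aestronglyMeasurable ?_
    unfold airyK Function.uncurry
    fun_prop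
  · simp only [Function.uncurry]
    rw [airyK_norm, ← Real.exp_add, ← Real.exp_add, ← Real.exp_add]
    refine (congrArg Real.exp ?_).le
    ring

lemma airy_conv (F : ℝ → ℂ) (hF : Integrable F) (c : ℝ) (hc : 0 < c) :
    (∫ s, F s) ^ 2 = ((2 * c ^ 2 : ℝ) : ℂ) *
      ∫ t : ℝ, ∫ z : ℝ, F (c * (t + z)) * F (c * (t - z)) := by
  have h := integral_convolution (ContinuousLinearMap.mul ℝ ℂ) hF hF (μ := volume) (ν := volume)
  simp only [ContinuousLinearMap.mul_apply'] at h
  rw [sq, ← h]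
  have h2 : ∀ u : ℝ, (MeasureTheory.convolution F F (ContinuousLinearMap.mul ℝ ℂ) volume) u
      = ∫ s, F s * F (u - s) := fun u => rfl
  simp_rw [h2]
  have h3 : ∀ t : ℝ, ∫ z : ℝ, F (c * (t + z)) * F (c * (t - z))
      = ((c⁻¹ : ℝ) : ℂ) * ∫ s, F s * F ((2 * c) * t - s) := by
    intro t
    have e1 := integral_add_left_eq_self (μ := volume)
      (fun z : ℝ => F (c * z) * F ((2 * c) * t - c * z)) t
    have e2 := Measure.integral_comp_mul_left (fun s : ℝ => F s * F ((2 * c) * t - s)) c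
    rw [abs_of_pos (inv_pos.2 hc), Complex.real_smul] at e2
    rw [← e2, ← e1]
    congr 1
    ext z
    congr 2
    ring
  simp_rw [h3]
  rw [integral_const_mul]
  have e3 := Measure.integral_comp_mul_left (fun u : ℝ => ∫ s, F s * F (u - s)) (2 * c)
  rw [abs_of_pos (inv_pos.2 (by positivity)), Complex.real_smul] at e3
  rw [e3]
  have hc' : (c : ℂ) ≠ 0 := by exact_mod_cast hc.ne'
  push_cast
  field_simp

/-- Airy squared identity
`∫ Ai(z² − y) dz = 2^{2/3} π Ai²(−y/2^{2/3})` for all real `y`, where `Ai` is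
the standard Airy function `Ai(x) = (1/π)∫₀^∞ cos(t³/3 + xt) dt` (as an
improper integral). -/
theorem stmt11 (Ai : ℝ → ℝ)
    (hAi : ∀ x : ℝ, Tendsto
      (fun R : ℝ => (1 / Real.pi) * ∫ t in (0:ℝ)..R, Real.cos (t ^ 3 / 3 + x * t))
      atTop (nhds (Ai x)))
    (y : ℝ) (hInt : Integrable (fun z : ℝ => Ai (z ^ 2 - y))) :
    (∫ z : ℝ, Ai (z ^ 2 - y))
      = (2 : ℝ) ^ ((2 : ℝ) / 3) * Real.pi * (Ai (-y / (2 : ℝ) ^ ((2 : ℝ) / 3))) ^ 2 := by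
  obtain ⟨c, hc, hc3, hk⟩ : ∃ c : ℝ, 0 < c ∧ c ^ 3 = 1 / 2 ∧ (2 : ℝ) ^ ((2 : ℝ) / 3) = 2 * c := by
    refine ⟨(2 : ℝ) ^ (-(1 : ℝ) / 3), by positivity, ?_, ?_⟩
    · rw [← Real.rpow_natCast, ← Real.rpow_mul (by norm_num)]
      norm_num [Real.rpow_neg_one]
    · rw [← Real.rpow_one_add' (by norm_num) (by norm_num)]
      norm_num
  rw [hk]
  have hA := airy_shift _ (-y / (2 * c)) c hc (hAi _)
  have hF := airyK_integrable (-y / (2 * c)) c hc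
  have hB := airy_conv _ hF c hc
  rw [hA] at hB
  have hcC : (c : ℂ) ≠ 0 := by exact_mod_cast hc.ne'
  have hc3C : (c : ℂ) ^ 3 = 1 / 2 := by
    rw [← Complex.ofReal_pow, hc3]
    norm_num
  have hprod : ∀ t z : ℝ,
      airyK (-y / (2 * c)) (((c * (t + z) : ℝ) : ℂ) + (c : ℂ) * Complex.I)
        * airyK (-y / (2 * c)) (((c * (t - z) : ℝ) : ℂ) + (c : ℂ) * Complex.I)
      = airyK (z ^ 2 - y) ((t : ℂ) + ((1 : ℝ) : ℂ) * Complex.I) := by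
    intro t z
    unfold airyK
    rw [← Complex.exp_add]
    congr 1
    push_cast
    have e1 : (-(y : ℂ) / (2 * c)) * (c * (t + z) + c * Complex.I)
        + (-(y : ℂ) / (2 * c)) * (c * (t - z) + c * Complex.I) = -y * (t + Complex.I) := by
      field_simp
      ring
    linear_combination Complex.I * e1 + Complex.I *
      (2 * (t + Complex.I) ^ 3 / 3 + 2 * (t + Complex.I) * z ^ 2) * hc3C
  simp_rw [hprod] at hB
  have hswap := integral_integral_swap (airy_prod_integrable y)
  rw [← hswap] at hB
  have hin : ∀ z : ℝ, ∫ t : ℝ, airyK (z ^ 2 - y) ((t : ℂ) + ((1 : ℝ) : ℂ) * Complex.I)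
      = ((2 * Real.pi * Ai (z ^ 2 - y) : ℝ) : ℂ) :=
    fun z => airy_shift _ _ 1 one_pos (hAi _)
  simp_rw [hin] at hB
  rw [integral_complex_ofReal, integral_const_mul] at hB
  norm_cast at hB
  have hpi := Real.pi_pos
  set J := ∫ z : ℝ, Ai (z ^ 2 - y)
  set a := Ai (-y / (2 * c))
  have h1 : Real.pi * a ^ 2 = c ^ 2 * J := by
    have : (4 * Real.pi) * (Real.pi * a ^ 2) = (4 * Real.pi) * (c ^ 2 * J) := by
      linear_combination hB
    exact mul_left_cancel₀ (by positivity) this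
  linear_combination (-2 * c) * h1 - 2 * J * hc3
end

section
/- Airy autoconvolution/orthogonality: for α, β > 0 with β ≠ α, (1/(αβ)) ∫_ℝ Ai((z+a)/α) Ai((z+b)/β) dz = |β³ − α³|^{−1/3} Ai((b−a)/(β³−α³)^{1/3}); when β = α the integral equals δ(b−a) in the sense that for fixed a, the function of b given by (1/α²)∫ Ai((z+a)/α)Ai((z+b)/α) dz converges to δ_{a} as a distribution when tested appropriately. -/
open MeasureTheory Filter

namespace AiryProof
open Complex Set Topology

/-- Airy kernel. -/
noncomputable def P (x : ℝ) (u : ℂ) : ℂ := cexp (I * (u ^ 3 / 3 + x * u))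

lemma norm_P (x t y : ℝ) : ‖P x (t + y * I)‖ = Real.exp (-(y * t ^ 2) + (y ^ 3 / 3 - x * y)) := by
  rw [P, Complex.norm_exp]
  congr 1
  have : I * (((t:ℂ) + y * I) ^ 3 / 3 + x * (t + y * I))
      = ((-(y * t ^ 2) + (y ^ 3 / 3 - x * y) : ℝ) : ℂ) + ((t ^ 3 / 3 - y ^ 2 * t + x * t : ℝ) : ℂ) * I := by
    push_cast
    have h2 : (I:ℂ) ^ 2 = -1 := I_sq
    have h3 : (I:ℂ) ^ 3 = -I := by rw [pow_succ, h2]; ring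
    have h4 : (I:ℂ) ^ 4 = 1 := by rw [show 4 = 2 * 2 from rfl, pow_mul, h2]; ring
    ring_nf
    simp only [h2, h3, h4]
    ring
  rw [this, add_re, ofReal_re, re_ofReal_mul, I_re, mul_zero, add_zero]

lemma differentiable_P (x : ℝ) : Differentiable ℂ (P x) := by
  unfold P; fun_prop

lemma continuous_P (x : ℝ) : Continuous (P x) := (differentiable_P x).continuous

lemma integrable_P (x y : ℝ) (hy : 0 < y) : Integrable (fun t : ℝ => P x (t + y * I)) := by
  have h : Integrable (fun t : ℝ => Real.exp (-y * t ^ 2) * Real.exp (y ^ 3 / 3 - x * y)) :=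
    (integrable_exp_neg_mul_sq hy).mul_const _
  refine h.mono' ?_ ?_
  · exact ((continuous_P x).comp (by fun_prop)).aestronglyMeasurable
  · refine Eventually.of_forall fun t => ?_
    rw [norm_P, ← Real.exp_add]
    simp

lemma tendsto_side (x y : ℝ) (hy : 0 < y) (c : ℝ → ℝ) (hc : ∀ R, c R ^ 2 = R ^ 2) :
    Tendsto (fun R : ℝ => ∫ s in (0:ℝ)..y, P x ((c R : ℝ) + s * I)) atTop (𝓝 0) := by
  have := intervalIntegral.tendsto_integral_filter_of_dominated_convergence
    (μ := volume) (a := 0) (b := y) (l := (atTop : Filter ℝ))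
    (F := fun R s => P x ((c R : ℝ) + s * I)) (f := fun _ => (0:ℂ))
    (fun _ => Real.exp (y ^ 3 / 3 + |x| * y)) ?_ ?_ ?_ ?_
  · simpa using this
  · refine Eventually.of_forall fun R => ?_
    exact ((continuous_P x).comp (by fun_prop)).aestronglyMeasurable
  · refine Eventually.of_forall fun R => Eventually.of_forall fun s hs => ?_
    rw [uIoc_of_le hy.le] at hs
    rw [norm_P]
    apply Real.exp_le_exp.2
    have h1 : 0 ≤ s * c R ^ 2 := mul_nonneg hs.1.le (sq_nonneg _)
    have h2 : s ^ 3 ≤ y ^ 3 := pow_le_pow_left₀ hs.1.le hs.2 3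
    have h3 : -x * s ≤ |x| * y := by
      calc -x * s ≤ |x| * s := mul_le_mul_of_nonneg_right (neg_le_abs x) hs.1.le
        _ ≤ |x| * y := mul_le_mul_of_nonneg_left hs.2 (abs_nonneg x)
    linarith
  · exact intervalIntegrable_const
  · refine Eventually.of_forall fun s hs => ?_
    rw [uIoc_of_le hy.le] at hs
    rw [tendsto_zero_iff_norm_tendsto_zero]
    simp only [norm_P, hc]
    apply Real.tendsto_exp_atBot.comp
    apply tendsto_atBot_add_const_right
    apply tendsto_neg_atTop_atBot.comp
    exact (tendsto_pow_atTop (by norm_num)).const_mul_atTop hs.1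

lemma tendsto_P (x y : ℝ) (hy : 0 < y) :
    Tendsto (fun R : ℝ => ∫ t in (-R)..R, P x t) atTop (𝓝 (∫ t : ℝ, P x (t + y * I))) := by
  have h1 := intervalIntegral_tendsto_integral (integrable_P x y hy) tendsto_neg_atTop_atBot
    (tendsto_id (α := ℝ) (x := atTop))
  have h2 := (tendsto_side x y hy (fun R => R) (fun R => rfl)).const_mul I
  have h3 := (tendsto_side x y hy (fun R => -R) (fun R => by ring)).const_mul I
  have h4 := (h1.sub h2).add h3
  simp only [mul_zero, sub_zero, add_zero] at h4
  refine h4.congr fun R => ?_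
  have := Complex.integral_boundary_rect_eq_zero_of_differentiableOn (P x) ((-R : ℝ) : ℂ)
    ((R : ℝ) + y * I) (differentiable_P x).differentiableOn
  simp only [ofReal_re, ofReal_im, add_re, mul_re, I_re, mul_zero, I_im, zero_mul, sub_zero,
    add_zero, add_im, mul_im, mul_one, zero_add, ofReal_zero, smul_eq_mul] at this
  simp only [id]
  linear_combination -this

lemma P_real (x R : ℝ) :
    ∫ t in (-R)..R, P x t = ((2 * ∫ t in (0:ℝ)..R, Real.cos (t ^ 3 / 3 + x * t) : ℝ) : ℂ) := by
  have hc : Continuous (fun t : ℝ => P x t) := (continuous_P x).comp continuous_ofReal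
  have hi : ∀ a b : ℝ, IntervalIntegrable (fun t : ℝ => P x t) volume a b :=
    fun a b => hc.intervalIntegrable a b
  rw [← intervalIntegral.integral_add_adjacent_intervals (hi (-R) 0) (hi 0 R)]
  have : ∫ t in (-R)..0, P x t = ∫ t in (0:ℝ)..R, P x ((-t : ℝ) : ℂ) := by
    rw [intervalIntegral.integral_comp_neg (fun t : ℝ => P x t)]; simp
  rw [this, ← intervalIntegral.integral_add]
  · rw [← intervalIntegral.integral_const_mul, ← intervalIntegral.integral_ofReal]
    congr 1
    ext t
    simp only [P]
    push_cast
    rw [two_mul, ← two_mul, Complex.two_cos]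
    rw [add_comm]
    congr 2 <;> ring
  · exact (hc.comp continuous_neg).intervalIntegrable _ _
  · exact hi 0 R

lemma Ai_eq (Ai : ℝ → ℝ)
    (hAi : ∀ x : ℝ, Tendsto
      (fun R : ℝ => (1 / Real.pi) * ∫ t in (0:ℝ)..R, Real.cos (t ^ 3 / 3 + x * t))
      atTop (nhds (Ai x))) (x y : ℝ) (hy : 0 < y) :
    (Ai x : ℂ) = (1 / (2 * Real.pi)) * ∫ t : ℝ, P x (t + y * I) := by
  have h1 := (tendsto_P x y hy).const_mul ((1 / (2 * Real.pi) : ℂ))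
  have h2 := (continuous_ofReal.tendsto _).comp (hAi x)
  refine tendsto_nhds_unique h2 (h1.congr fun R => ?_)
  rw [P_real]
  simp only [Function.comp]
  have : (Real.pi : ℂ) ≠ 0 := by exact_mod_cast Real.pi_ne_zero
  push_cast
  field_simp

lemma Ai_scaled (Ai : ℝ → ℝ)
    (hAi : ∀ x : ℝ, Tendsto
      (fun R : ℝ => (1 / Real.pi) * ∫ t in (0:ℝ)..R, Real.cos (t ^ 3 / 3 + x * t))
      atTop (nhds (Ai x))) (x y c : ℝ) (hy : 0 < y) (hc : 0 < c) :
    ((1 / c * Ai (x / c) : ℝ) : ℂ) =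
      ∫ v : ℝ, cexp (I * (c ^ 3 * ((2 * Real.pi * v : ℝ) + y * I) ^ 3 / 3
        + x * ((2 * Real.pi * v : ℝ) + y * I))) := by
  have h := Measure.integral_comp_mul_left (fun t : ℝ => P (x / c) (t + (c * y : ℝ) * I))
    (c * (2 * Real.pi))
  have hpi := Real.pi_pos
  have h' := Ai_eq Ai hAi (x / c) (c * y) (by positivity)
  have hcc : (c : ℂ) ≠ 0 := by exact_mod_cast hc.ne'
  have hpc : (Real.pi : ℂ) ≠ 0 := by exact_mod_cast Real.pi_ne_zero
  push_cast at h' ⊢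
  rw [h']
  rw [abs_of_pos (by positivity)] at h
  have e : ∀ v : ℝ, cexp (I * (c ^ 3 * ((2 * Real.pi * v : ℂ) + y * I) ^ 3 / 3
        + x * ((2 * Real.pi * v : ℂ) + y * I))) =
      P (x / c) ((c * (2 * Real.pi) * v : ℝ) + (c * y : ℝ) * I) := by
    intro v
    unfold P
    congr 1
    push_cast
    field_simp
  simp only [e, h]
  push_cast
  rw [Complex.real_smul]
  push_cast
  field_simp

lemma norm_bound (x t : ℝ) (k : ℕ) (hk : k ≤ 2) :
    ‖(I * ((t : ℂ) + I)) ^ k * P x (t + I)‖ ≤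
      2 * Real.exp (1 / 3 - x) * Real.exp (-(1 / 2) * t ^ 2) := by
  have h0 := norm_P x t 1
  simp only [ofReal_one, one_mul] at h0
  rw [norm_mul, h0, norm_pow, norm_mul, norm_I, one_mul]
  have hsq : ‖(t : ℂ) + I‖ ^ 2 = t ^ 2 + 1 := by
    rw [← Complex.normSq_eq_norm_sq, Complex.normSq_apply]; simp; ring
  have h1 : 1 ≤ ‖(t : ℂ) + I‖ := by
    by_contra h
    push Not at h
    nlinarith [norm_nonneg ((t : ℂ) + I), sq_nonneg t]
  have h2 : ‖(t : ℂ) + I‖ ^ k ≤ 2 * Real.exp (1 / 2 * t ^ 2) := by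
    calc _ ≤ ‖(t : ℂ) + I‖ ^ 2 := pow_le_pow_right₀ h1 hk
      _ = t ^ 2 + 1 := hsq
      _ ≤ _ := by nlinarith [Real.add_one_le_exp (1 / 2 * t ^ 2)]
  calc _ ≤ 2 * Real.exp (1 / 2 * t ^ 2) * Real.exp (-(t ^ 2) + (1 ^ 3 / 3 - x * 1)) :=
        mul_le_mul_of_nonneg_right h2 (Real.exp_pos _).le
    _ = _ := by
        rw [mul_assoc, mul_assoc, ← Real.exp_add, ← Real.exp_add]
        congr 2; ring

lemma integrable_bound (x : ℝ) :
    Integrable (fun t : ℝ => 2 * Real.exp (1 / 3 - x) * Real.exp (-(1 / 2) * t ^ 2)) :=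
  (integrable_exp_neg_mul_sq (by norm_num)).const_mul _

/-- derivatives of the Airy integral -/
noncomputable def G (k : ℕ) (x : ℝ) : ℂ := ∫ t : ℝ, (I * ((t : ℂ) + I)) ^ k * P x (t + I)

lemma meas_G (k : ℕ) (x : ℝ) :
    AEStronglyMeasurable (fun t : ℝ => (I * ((t : ℂ) + I)) ^ k * P x (t + I)) volume := by
  apply Continuous.aestronglyMeasurable
  have := (continuous_P x).comp (show Continuous (fun t : ℝ => (t : ℂ) + I) by fun_prop)
  exact (by fun_prop : Continuous (fun t : ℝ => (I * ((t : ℂ) + I)) ^ k)).mul this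

lemma integrable_G (k : ℕ) (hk : k ≤ 2) (x : ℝ) :
    Integrable (fun t : ℝ => (I * ((t : ℂ) + I)) ^ k * P x (t + I)) :=
  (integrable_bound x).mono' (meas_G k x) (Eventually.of_forall fun t => norm_bound x t k hk)

lemma hasDerivAt_G (k : ℕ) (hk : k ≤ 1) (x : ℝ) : HasDerivAt (G k) (G (k + 1) x) x := by
  refine (hasDerivAt_integral_of_dominated_loc_of_deriv_le (μ := volume) (s := Ioi (x - 1))
    (F := fun (x : ℝ) (t : ℝ) => (I * ((t : ℂ) + I)) ^ k * P x (t + I))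
    (F' := fun (x : ℝ) (t : ℝ) => (I * ((t : ℂ) + I)) ^ (k + 1) * P x (t + I))
    (bound := fun t : ℝ => 2 * Real.exp (1 / 3 - (x - 1)) * Real.exp (-(1 / 2) * t ^ 2))
    (Ioi_mem_nhds (by linarith)) (Eventually.of_forall fun x => meas_G k x)
    (integrable_G k (by omega) x) (meas_G _ x) ?_ (integrable_bound _) ?_).2
  · refine Eventually.of_forall fun t x' hx' => ?_
    refine (norm_bound x' t (k + 1) (by omega)).trans ?_
    have : x - 1 < x' := hx'
    gcongr
  · refine Eventually.of_forall fun t x' _ => ?_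
    have h1 : HasDerivAt (fun x : ℝ => P x ((t : ℂ) + I))
        (P x' ((t : ℂ) + I) * (I * ((t : ℂ) + I))) x' := by
      unfold P
      apply HasDerivAt.cexp
      have := ((((hasDerivAt_id x').ofReal_comp).mul_const ((t : ℂ) + I)).const_add
        (((t : ℂ) + I) ^ 3 / 3)).const_mul I
      simpa using this
    have := h1.const_mul ((I * ((t : ℂ) + I)) ^ k)
    refine this.congr_deriv ?_
    ring

lemma G_two (x : ℝ) : G 2 x = x * G 0 x := by
  have hd : ∀ t : ℝ, HasDerivAt (fun t : ℝ => P x ((t : ℂ) + I))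
      (-I * ((I * ((t : ℂ) + I)) ^ 2 * P x (t + I) - x * ((I * ((t : ℂ) + I)) ^ 0 * P x (t + I)))) t := by
    intro t
    have h0 : HasDerivAt (fun t : ℝ => (t : ℂ) + I) 1 t := by
      simpa using ((hasDerivAt_id t).ofReal_comp).add_const I
    have h1 := ((((h0.pow 3).div_const 3).add (h0.const_mul (x : ℂ))).const_mul I).cexp
    refine HasDerivAt.congr_deriv (f := fun t : ℝ => P x ((t : ℂ) + I)) h1 ?_
    have h2 : (I:ℂ) ^ 2 = -1 := I_sq
    change P x ((t : ℂ) + I) * _ = _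
    simp only [mul_pow, h2]
    push_cast
    ring
  have hi : Integrable (fun t : ℝ => (-I * ((I * ((t : ℂ) + I)) ^ 2 * P x (t + I)
      - x * ((I * ((t : ℂ) + I)) ^ 0 * P x (t + I))))) :=
    ((integrable_G 2 le_rfl x).sub ((integrable_G 0 (by norm_num) x).const_mul _)).const_mul _
  have hP : Integrable (fun t : ℝ => P x ((t : ℂ) + I)) := by
    simpa using integrable_G 0 (by norm_num) x
  have := integral_eq_zero_of_hasDerivAt_of_integrable hd hi hP
  rw [integral_const_mul, integral_sub (integrable_G 2 le_rfl x)
    ((integrable_G 0 (by norm_num) x).const_mul _), integral_const_mul] at this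
  have h3 := (mul_eq_zero.1 this).resolve_left (by simp)
  exact sub_eq_zero.1 h3

lemma G_bound (k : ℕ) (hk : k ≤ 2) : ∃ C, 0 ≤ C ∧ ∀ x, ‖G k x‖ ≤ C * Real.exp (-x) := by
  refine ⟨∫ t : ℝ, 2 * Real.exp (1 / 3) * Real.exp (-(1 / 2) * t ^ 2),
    integral_nonneg fun t => by positivity, fun x => ?_⟩
  rw [← integral_mul_const]
  refine norm_integral_le_of_norm_le ?_ (Eventually.of_forall fun t => ?_)
  · exact ((integrable_exp_neg_mul_sq (by norm_num)).const_mul _).mul_const _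
  · refine (norm_bound x t k hk).trans (le_of_eq ?_)
    rw [sub_eq_add_neg, Real.exp_add]; ring

/-- Summary of the real-variable facts about the Airy function. -/
lemma Ai_facts (Ai : ℝ → ℝ)
    (hAi : ∀ x : ℝ, Tendsto
      (fun R : ℝ => (1 / Real.pi) * ∫ t in (0:ℝ)..R, Real.cos (t ^ 3 / 3 + x * t))
      atTop (nhds (Ai x))) :
    ∃ (D : ℝ → ℝ) (C : ℝ), 0 ≤ C ∧ (∀ x, HasDerivAt Ai (D x) x) ∧
      (∀ x, HasDerivAt D (x * Ai x) x) ∧ (∀ x, |Ai x| ≤ C * Real.exp (-x)) := by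
  obtain ⟨C, hC0, hC⟩ := G_bound 0 (by norm_num)
  have e : ∀ x, Ai x = 1 / (2 * Real.pi) * (G 0 x).re := by
    intro x
    have := Ai_eq Ai hAi x 1 one_pos
    have h2 : (∫ t : ℝ, P x (t + (1:ℝ) * I)) = G 0 x := by simp [G]
    rw [h2] at this
    have h3 := congrArg Complex.re this
    rw [ofReal_re, show (1 / (2 * Real.pi) : ℂ) = ((1 / (2 * Real.pi) : ℝ) : ℂ) by push_cast; rfl,
      Complex.re_ofReal_mul] at h3
    exact h3
  have hre : ∀ k, k ≤ 1 → ∀ x, HasDerivAt (fun x => 1 / (2 * Real.pi) * (G k x).re)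
      (1 / (2 * Real.pi) * (G (k+1) x).re) x := by
    intro k hk x
    have := (Complex.reCLM.hasFDerivAt.comp_hasDerivAt x (hasDerivAt_G k hk x))
    exact HasDerivAt.const_mul _ this
  have hpi := Real.pi_pos
  refine ⟨fun x => 1 / (2 * Real.pi) * (G 1 x).re, 1 / (2 * Real.pi) * C, by positivity, ?_, ?_, ?_⟩
  · rw [show Ai = _ from funext e]
    exact hre 0 (by norm_num)
  · intro x
    have := hre 1 le_rfl x
    rw [G_two, Complex.re_ofReal_mul] at this
    rw [e]
    convert this using 1
    ring
  · intro x
    rw [e, abs_mul, abs_of_pos (by positivity), mul_assoc]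
    gcongr
    exact (Complex.abs_re_le_norm _).trans (hC x)

end AiryProof

namespace AiryProof
open Set Topology

lemma energy (A D : ℝ → ℝ) (C : ℝ) (hC : 0 ≤ C) (hA : ∀ x, HasDerivAt A (D x) x)
    (hD : ∀ x, HasDerivAt D (x * A x) x) (hb : ∀ x, |A x| ≤ C * Real.exp (-x)) :
    ∃ K, 0 ≤ K ∧ (∀ x, |A x| ≤ K) ∧ ∀ x, x ≤ -1 → |D x| ≤ K * √(-x) := by
  set E : ℝ → ℝ := fun x => A x ^ 2 + D x ^ 2 / (-x) with hE
  have hder : ∀ x, x < 0 → HasDerivAt E (D x ^ 2 / x ^ 2) x := by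
    intro x hx
    have h1 := ((hA x).pow 2).add (((hD x).pow 2).div ((hasDerivAt_id x).neg) (by simpa using hx.ne))
    refine HasDerivAt.congr_deriv (f := E) h1 ?_
    have : x ≠ 0 := hx.ne
    simp only [Pi.neg_apply, Pi.pow_apply, id]
    field_simp
    ring
  have hmono : MonotoneOn E (Iic (-1)) := by
    apply monotoneOn_of_deriv_nonneg (convex_Iic _)
    · intro x hx
      exact (hder x (by have : x ≤ -1 := hx; linarith)).continuousAt.continuousWithinAt
    · intro x hx
      rw [interior_Iic] at hx
      exact (hder x (by have : x < -1 := hx; linarith)).differentiableAt.differentiableWithinAt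
    · intro x hx
      rw [interior_Iic] at hx
      rw [(hder x (by have : x < -1 := hx; linarith)).deriv]
      positivity
  have hEle : ∀ x, x ≤ -1 → E x ≤ E (-1) := fun x hx => hmono hx (by simp) hx
  have h0 : 0 ≤ E (-1) := by simp only [hE]; norm_num; positivity
  have hs := Real.sqrt_nonneg (E (-1))
  refine ⟨C * Real.exp 1 + √(E (-1)), by positivity, ?_, ?_⟩
  · intro x
    rcases le_total x (-1) with hx | hx
    · have h1 : A x ^ 2 ≤ E (-1) := by
        refine le_trans ?_ (hEle x hx)
        have : 0 ≤ D x ^ 2 / (-x) := div_nonneg (sq_nonneg _) (by linarith)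
        simp only [hE]; linarith
      have := Real.abs_le_sqrt h1
      have : 0 ≤ C * Real.exp 1 := by positivity
      linarith
    · have h1 : C * Real.exp (-x) ≤ C * Real.exp 1 := by gcongr; linarith
      linarith [hb x]
  · intro x hx
    have h1 : D x ^ 2 ≤ E (-1) * (-x) := by
      rw [← div_le_iff₀ (by linarith)]
      refine le_trans ?_ (hEle x hx)
      simp only [hE]; nlinarith [sq_nonneg (A x)]
    have h2 := Real.abs_le_sqrt h1
    rw [Real.sqrt_mul h0] at h2
    have : 0 ≤ C * Real.exp 1 * √(-x) := by positivity
    linarith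

lemma conv (h W : ℝ → ℝ) (κ δ C Y : ℝ) (hκ : 0 < κ) (hC : 0 ≤ C) (hh : Continuous h)
    (hW : ∀ y, HasDerivAt W ((κ * y - δ) * h y) y) (hb : ∀ y, Y ≤ y → |W y| ≤ C * √y) :
    ∃ l, Tendsto (fun R => ∫ y in (0:ℝ)..R, h y) atTop (𝓝 l) := by
  obtain ⟨Z, hZY, hZ1, hZδ⟩ : ∃ Z, Y ≤ Z ∧ 1 ≤ Z ∧ 2 * |δ| / κ ≤ Z :=
    ⟨max Y (max 1 (2 * |δ| / κ)), le_max_left _ _, (le_max_left _ _).trans (le_max_right _ _),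
      (le_max_right _ _).trans (le_max_right _ _)⟩
  have hL : ∀ y, Z ≤ y → κ * y / 2 ≤ κ * y - δ := by
    intro y hy
    have h1 : 2 * |δ| / κ ≤ y := hZδ.trans hy
    rw [div_le_iff₀ hκ] at h1
    nlinarith [le_abs_self δ]
  have hLp : ∀ y, Z ≤ y → 0 < κ * y - δ := fun y hy =>
    lt_of_lt_of_le (by have : 0 < y := by linarith
                       positivity) (hL y hy)
  have hWc : Continuous W := continuous_iff_continuousAt.2 fun y => (hW y).continuousAt
  set V : ℝ → ℝ := fun y => W y / (κ * y - δ) with hV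
  set r : ℝ → ℝ := fun y => κ * W y / (κ * y - δ) ^ 2 with hr
  have hVd : ∀ y, Z ≤ y → HasDerivAt V (h y - r y) y := by
    intro y hy
    have hne := (hLp y hy).ne'
    have h1 : HasDerivAt (fun y : ℝ => κ * y - δ) κ y := by
      simpa using ((hasDerivAt_id y).const_mul κ).sub_const δ
    refine HasDerivAt.congr_deriv (f := V) ((hW y).div h1 hne) ?_
    simp only [hr]
    field_simp
  have hrc : ContinuousOn r (Ici Z) := by
    intro y hy
    have hne := (hLp y hy).ne'
    have : ContinuousAt r y := by
      have h1 : ContinuousAt (fun y => κ * W y) y := by fun_prop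
      have h2 : ContinuousAt (fun y => (κ * y - δ) ^ 2) y := by fun_prop
      exact h1.div h2 (pow_ne_zero 2 hne)
    exact this.continuousWithinAt
  have hri : IntegrableOn r (Ioi Z) := by
    have hg : IntegrableOn (fun y : ℝ => 4 * C / κ * y ^ (-(3/2) : ℝ)) (Ioi Z) :=
      (integrableOn_Ioi_rpow_of_lt (by norm_num) (by linarith)).const_mul _
    refine Integrable.mono' hg ?_ ?_
    · exact (hrc.mono Ioi_subset_Ici_self).aestronglyMeasurable measurableSet_Ioi
    · rw [ae_restrict_iff' measurableSet_Ioi]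
      refine Eventually.of_forall fun y hy => ?_
      have hy : Z < y := hy
      have hy0 : 0 < y := by linarith
      have hl := hL y hy.le
      have hp := hLp y hy.le
      have hbb := hb y (by linarith)
      simp only [hr, Real.norm_eq_abs]
      rw [abs_div, abs_mul, abs_of_pos hκ, abs_of_pos (pow_pos hp 2)]
      have h2 : y ^ (-(3/2) : ℝ) = √y / y ^ 2 := by
        rw [Real.sqrt_eq_rpow, ← Real.rpow_natCast y 2, ← Real.rpow_sub hy0]; norm_num
      rw [h2]
      calc κ * |W y| / (κ * y - δ) ^ 2 ≤ κ * (C * √y) / (κ * y / 2) ^ 2 := by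
            gcongr
        _ = _ := by field_simp; norm_num
  have hV0 : Tendsto V atTop (𝓝 0) := by
    have hg : Tendsto (fun y : ℝ => 2 * C / κ * y ^ (-(1/2) : ℝ)) atTop (𝓝 0) := by
      simpa using (tendsto_rpow_neg_atTop (show (0:ℝ) < 1/2 by norm_num)).const_mul (2 * C / κ)
    refine squeeze_zero_norm' ?_ hg
    filter_upwards [eventually_ge_atTop Z] with y hy
    have hy0 : 0 < y := by linarith
    have hl := hL y hy
    have hp := hLp y hy
    have hbb := hb y (by linarith)
    simp only [hV, Real.norm_eq_abs]
    rw [abs_div, abs_of_pos hp]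
    have h2 : y ^ (-(1/2) : ℝ) = √y / y := by
      rw [Real.sqrt_eq_rpow]
      nth_rw 3 [← Real.rpow_one y]
      rw [← Real.rpow_sub hy0]; norm_num
    rw [h2]
    calc |W y| / (κ * y - δ) ≤ (C * √y) / (κ * y / 2) := by gcongr
      _ = _ := by field_simp
  have h1 := intervalIntegral_tendsto_integral_Ioi Z hri (tendsto_id (α := ℝ) (x := atTop))
  have h2 := ((hV0.sub_const (V Z)).add h1).const_add (∫ y in (0:ℝ)..Z, h y)
  refine ⟨_, h2.congr' ?_⟩
  filter_upwards [eventually_ge_atTop Z] with R hR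
  have hi : ∀ u v, IntervalIntegrable h volume u v := fun u v => hh.intervalIntegrable u v
  have hri' : IntervalIntegrable r volume Z R := by
    apply ContinuousOn.intervalIntegrable
    rw [uIcc_of_le hR]
    exact hrc.mono Icc_subset_Ici_self
  rw [← intervalIntegral.integral_add_adjacent_intervals (hi 0 Z) (hi Z R)]
  congr 1
  have h3 := intervalIntegral.integral_eq_sub_of_hasDerivAt (a := Z) (b := R) (f := V)
    (f' := fun y => h y - r y)
    (fun y hy => hVd y (by rw [uIcc_of_le hR] at hy; exact hy.1)) ((hi Z R).sub hri')
  rw [intervalIntegral.integral_sub (hi Z R) hri'] at h3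
  simp only [id]
  linarith

lemma conv_product (A D : ℝ → ℝ) (K : ℝ) (hK : 0 ≤ K) (hA : ∀ x, HasDerivAt A (D x) x)
    (hD : ∀ x, HasDerivAt D (x * A x) x) (hb : ∀ x, |A x| ≤ K)
    (hDb : ∀ x, x ≤ -1 → |D x| ≤ K * √(-x)) (a b α β : ℝ) (hα : 0 < α) (hαβ : α < β) :
    ∃ l, Tendsto (fun R => ∫ y in (0:ℝ)..R, A ((-y + a) / α) * A ((-y + b) / β)) atTop (𝓝 l) := by
  have hβ : 0 < β := hα.trans hαβ
  have hAc : Continuous A := continuous_iff_continuousAt.2 fun y => (hA y).continuousAt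
  have hlin : ∀ c γ y : ℝ, HasDerivAt (fun y : ℝ => (-y + c) / γ) (-1 / γ) y := fun c γ y =>
    (((hasDerivAt_id y).neg).add_const c).div_const γ
  have hDbound : ∀ c γ : ℝ, 0 < γ → ∃ M Y, 0 ≤ M ∧ ∀ y, Y ≤ y → |D ((-y + c) / γ)| ≤ M * √y := by
    intro c γ hγ
    refine ⟨K * √((1 + |c|) / γ), max 1 (c + γ), by positivity, fun y hy => ?_⟩
    have hy1 : 1 ≤ y := (le_max_left _ _).trans hy
    have hy2 : c + γ ≤ y := (le_max_right _ _).trans hy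
    have h1 : (-y + c) / γ ≤ -1 := by rw [div_le_iff₀ hγ]; linarith
    refine (hDb _ h1).trans ?_
    rw [mul_assoc, ← Real.sqrt_mul (by positivity)]
    gcongr
    rw [div_mul_eq_mul_div, ← neg_div]
    gcongr
    nlinarith [neg_abs_le c, abs_nonneg c]
  obtain ⟨M1, Y1, hM1, h1⟩ := hDbound a α hα
  obtain ⟨M2, Y2, hM2, h2⟩ := hDbound b β hβ
  refine conv _ (fun y => D ((-y + a) / α) / α * A ((-y + b) / β)
      - A ((-y + a) / α) * (D ((-y + b) / β) / β)) (1 / α ^ 3 - 1 / β ^ 3)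
    (a / α ^ 3 - b / β ^ 3) (M1 / α * K + K * (M2 / β)) (max Y1 Y2) ?_ (by positivity)
    (by fun_prop) ?_ ?_
  · rw [sub_pos]
    apply one_div_lt_one_div_of_lt (by positivity)
    gcongr
  · intro y
    have dA1 := (hA ((-y + a) / α)).comp y (hlin a α y)
    have dA2 := (hA ((-y + b) / β)).comp y (hlin b β y)
    have dD1 := (hD ((-y + a) / α)).comp y (hlin a α y)
    have dD2 := (hD ((-y + b) / β)).comp y (hlin b β y)
    have := ((dD1.div_const α).mul dA2).sub (dA1.mul (dD2.div_const β))
    refine HasDerivAt.congr_deriv (f := fun y => D ((-y + a) / α) / α * A ((-y + b) / β)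
      - A ((-y + a) / α) * (D ((-y + b) / β) / β)) this ?_
    simp only [Function.comp]
    field_simp
    ring
  · intro y hy
    have e1 := h1 y ((le_max_left _ _).trans hy)
    have e2 := h2 y ((le_max_right _ _).trans hy)
    have hs := Real.sqrt_nonneg y
    calc _ ≤ |D ((-y + a) / α) / α * A ((-y + b) / β)|
          + |A ((-y + a) / α) * (D ((-y + b) / β) / β)| := abs_sub _ _
      _ ≤ (M1 * √y) / α * K + K * ((M2 * √y) / β) := by
          rw [abs_mul, abs_mul, abs_div, abs_div, abs_of_pos hα, abs_of_pos hβ]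
          gcongr
          · exact hb _
          · exact hb _
      _ = _ := by ring

lemma abel (h : ℝ → ℝ) (K l : ℝ) (hh : Continuous h) (hb : ∀ y, |h y| ≤ K)
    (hl : Tendsto (fun R => ∫ y in (0:ℝ)..R, h y) atTop (𝓝 l)) :
    Tendsto (fun ε : ℝ => ∫ y in Ioi (0:ℝ), Real.exp (-ε * y) * h y) (𝓝[>] 0) (𝓝 l) := by
  set H : ℝ → ℝ := fun R => ∫ y in (0:ℝ)..R, h y with hH
  have hHd : ∀ y, HasDerivAt H (h y) y := fun y =>
    intervalIntegral.integral_hasDerivAt_right (hh.intervalIntegrable _ _)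
      (hh.stronglyMeasurableAtFilter _ _) hh.continuousAt
  have hHc : Continuous H := continuous_iff_continuousAt.2 fun y => (hHd y).continuousAt
  obtain ⟨M, hM⟩ : ∃ M, ∀ y, 0 ≤ y → |H y| ≤ M := by
    have h1 : ∀ᶠ y in atTop, |H y| ≤ |l| + 1 :=
      (hl.abs).eventually_le_const (by linarith)
    obtain ⟨Y, hY⟩ := eventually_atTop.1 h1
    obtain ⟨M1, hM1⟩ := (isCompact_Icc (a := (0:ℝ)) (b := Y)).exists_bound_of_continuousOn
      hHc.continuousOn
    refine ⟨max M1 (|l| + 1), fun y hy => ?_⟩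
    rcases le_total y Y with h | h
    · exact (hM1 y ⟨hy, h⟩).trans (le_max_left _ _)
    · exact (hY y h).trans (le_max_right _ _)
  have hexp : ∀ ε : ℝ, 0 < ε → IntegrableOn (fun y : ℝ => Real.exp (-ε * y)) (Ioi 0) :=
    fun ε hε => exp_neg_integrableOn_Ioi 0 hε
  have hint : ∀ ε : ℝ, 0 < ε → ∀ (f : ℝ → ℝ) (B : ℝ), Continuous f → (∀ y, 0 ≤ y → |f y| ≤ B) →
      IntegrableOn (fun y : ℝ => Real.exp (-ε * y) * f y) (Ioi 0) := by
    intro ε hε f B hf hB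
    refine Integrable.mono' ((hexp ε hε).mul_const B) ?_ ?_
    · exact (by fun_prop : Continuous fun y : ℝ => Real.exp (-ε * y) * f y).aestronglyMeasurable
    · rw [ae_restrict_iff' measurableSet_Ioi]
      refine Eventually.of_forall fun y hy => ?_
      rw [norm_mul, Real.norm_of_nonneg (Real.exp_pos _).le]
      gcongr
      exact hB y (le_of_lt hy)
  have key : ∀ ε : ℝ, 0 < ε → ∫ y in Ioi (0:ℝ), Real.exp (-ε * y) * h y =
      ∫ y in Ioi (0:ℝ), Real.exp (-1 * y) * H (ε⁻¹ * y) := by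
    intro ε hε
    have hu : ∀ y : ℝ, HasDerivAt (fun y : ℝ => Real.exp (-ε * y)) (Real.exp (-ε * y) * (-ε)) y := by
      intro y
      have := ((hasDerivAt_id y).const_mul (-ε)).exp
      simpa using this
    have hi2 := hint ε hε H M hHc hM
    have hlim : Tendsto (fun y : ℝ => Real.exp (-ε * y)) atTop (𝓝 0) := by
      apply Real.tendsto_exp_atBot.comp
      exact tendsto_id.const_mul_atTop_of_neg (by linarith)
    have h1 := integral_Ioi_mul_deriv_eq_deriv_mul (a := 0) (a' := 0) (b' := 0)
      (u := fun y : ℝ => Real.exp (-ε * y)) (v := H) (u' := fun y => Real.exp (-ε * y) * (-ε))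
      (v' := h) (fun y _ => hu y) (fun y _ => hHd y) (hint ε hε h K hh (fun y _ => hb y))
      (by
        have := hi2.const_mul (-ε)
        refine this.congr (Eventually.of_forall fun y => ?_)
        simp only [Pi.mul_apply]; ring)
      (by
        have : ContinuousAt ((fun y : ℝ => Real.exp (-ε * y)) * H) 0 := by
          apply ContinuousAt.mul <;> fun_prop
        have h2 : ((fun y : ℝ => Real.exp (-ε * y)) * H) 0 = 0 := by simp [hH]
        have h3 := this.tendsto
        rw [h2] at h3
        exact h3.mono_left nhdsWithin_le_nhds)
      (by simpa using! hlim.mul hl)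
    rw [h1]
    have h2 := integral_comp_mul_left_Ioi (fun y => Real.exp (-1 * y) * H (ε⁻¹ * y)) 0 hε
    rw [mul_zero] at h2
    have h3 : ∫ y in Ioi (0:ℝ), Real.exp (-1 * y) * H (ε⁻¹ * y) =
        ε * ∫ y in Ioi (0:ℝ), Real.exp (-1 * (ε * y)) * H (ε⁻¹ * (ε * y)) := by
      rw [h2, smul_eq_mul]; field_simp
    rw [h3, ← integral_const_mul, sub_self, zero_sub, ← integral_neg]
    congr 1
    ext y
    rw [inv_mul_cancel_left₀ hε.ne']
    ring_nf
  have hlim : Tendsto (fun ε : ℝ => ∫ y in Ioi (0:ℝ), Real.exp (-1 * y) * H (ε⁻¹ * y)) (𝓝[>] 0)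
      (𝓝 (∫ y in Ioi (0:ℝ), Real.exp (-1 * y) * l)) := by
    refine tendsto_integral_filter_of_dominated_convergence (fun y => Real.exp (-1 * y) * M) ?_ ?_
      ((hexp 1 one_pos).mul_const M) ?_
    · refine Eventually.of_forall fun ε => ?_
      exact (by fun_prop : Continuous fun y : ℝ => Real.exp (-1 * y) * H (ε⁻¹ * y)).aestronglyMeasurable
    · filter_upwards [self_mem_nhdsWithin] with ε hε
      rw [ae_restrict_iff' measurableSet_Ioi]
      refine Eventually.of_forall fun y hy => ?_
      rw [norm_mul, Real.norm_of_nonneg (Real.exp_pos _).le]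
      gcongr
      exact hM _ (mul_nonneg (inv_nonneg.2 (le_of_lt hε)) (le_of_lt hy))
    · rw [ae_restrict_iff' measurableSet_Ioi]
      refine Eventually.of_forall fun y hy => ?_
      apply Tendsto.const_mul
      exact hl.comp (tendsto_inv_nhdsGT_zero.atTop_mul_const hy)
  have hone : ∫ y in Ioi (0:ℝ), Real.exp (-1 * y) * l = l := by
    rw [integral_mul_const]
    have := integral_exp_neg_Ioi_zero
    simp only [neg_one_mul, this, one_mul]
  rw [hone] at hlim
  refine hlim.congr' ?_
  filter_upwards [self_mem_nhdsWithin] with ε hε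
  exact (key ε hε).symm

end AiryProof

namespace AiryProof
open Set Topology

lemma exp_int (f : ℝ → ℝ) (K C d η : ℝ) (hf : Continuous f) (hK : ∀ z, |f z| ≤ K)
    (hC : ∀ z, |f z| ≤ C * Real.exp (-d * z)) (hη : 0 < η) (hd : η < d) :
    Integrable (fun z => Real.exp (η * z) * f z) := by
  have hc : Continuous (fun z => Real.exp (η * z) * f z) := by fun_prop
  rw [← integrableOn_univ, ← Iic_union_Ioi (a := (0:ℝ))]
  refine IntegrableOn.union ?_ ?_
  · have h1 : IntegrableOn (fun z : ℝ => Real.exp (η * z) * K) (Iic 0) := by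
      refine Integrable.mul_const ?_ K
      exact integrableOn_exp_mul_Iic hη 0
    refine Integrable.mono' h1 hc.aestronglyMeasurable (Eventually.of_forall fun z => ?_)
    rw [norm_mul, Real.norm_of_nonneg (Real.exp_pos _).le]
    gcongr
    exact hK z
  · have h1 : IntegrableOn (fun z : ℝ => C * Real.exp (-(d - η) * z)) (Ioi 0) :=
      (exp_neg_integrableOn_Ioi 0 (by linarith)).const_mul C
    refine Integrable.mono' h1 hc.aestronglyMeasurable (Eventually.of_forall fun z => ?_)
    rw [norm_mul, Real.norm_of_nonneg (Real.exp_pos _).le]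
    calc _ ≤ Real.exp (η * z) * (C * Real.exp (-d * z)) := by
          gcongr
          exact hC z
      _ = C * Real.exp (-(d - η) * z) := by
          rw [mul_left_comm, ← Real.exp_add]; ring_nf

lemma assemble (h : ℝ → ℝ) (K C d l T : ℝ) (hh : Continuous h) (hK : ∀ z, |h z| ≤ K)
    (hC : ∀ z, |h z| ≤ C * Real.exp (-d * z)) (hd : 0 < d)
    (hl : Tendsto (fun R => ∫ y in (0:ℝ)..R, h (-y)) atTop (𝓝 l))
    (hT : Tendsto (fun ε : ℝ => ∫ z, Real.exp (ε * z) * h z) (𝓝[>] 0) (𝓝 T)) :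
    Tendsto (fun R => ∫ z in (-R)..R, h z) atTop (𝓝 T) := by
  have hC0 : 0 ≤ C := by simpa using (abs_nonneg _).trans (hC 0)
  have hhi : IntegrableOn h (Ioi 0) := by
    refine Integrable.mono' ((exp_neg_integrableOn_Ioi 0 hd).const_mul C)
      hh.aestronglyMeasurable (Eventually.of_forall fun z => hC z)
  have h1 := abel (fun y => h (-y)) K l (by fun_prop) (fun y => hK _) hl
  have h2 : Tendsto (fun ε : ℝ => ∫ z in Ioi (0:ℝ), Real.exp (ε * z) * h z) (𝓝[>] 0)
      (𝓝 (∫ z in Ioi (0:ℝ), h z)) := by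
    refine tendsto_integral_filter_of_dominated_convergence
      (fun z => C * Real.exp (-(d / 2) * z)) ?_ ?_
      ((exp_neg_integrableOn_Ioi 0 (by linarith)).const_mul C) ?_
    · refine Eventually.of_forall fun ε => ?_
      exact (by fun_prop : Continuous fun z => Real.exp (ε * z) * h z).aestronglyMeasurable
    · have : Iio (d / 2) ∈ 𝓝[>] (0:ℝ) := nhdsWithin_le_nhds (Iio_mem_nhds (by linarith))
      filter_upwards [this] with ε hε
      rw [ae_restrict_iff' measurableSet_Ioi]
      refine Eventually.of_forall fun z hz => ?_
      have hz : 0 < z := hz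
      have hε : ε < d / 2 := hε
      rw [norm_mul, Real.norm_of_nonneg (Real.exp_pos _).le]
      calc _ ≤ Real.exp (ε * z) * (C * Real.exp (-d * z)) := by
            gcongr
            exact hC z
        _ = C * Real.exp (ε * z + -d * z) := by rw [Real.exp_add]; ring
        _ ≤ _ := by
            gcongr
            nlinarith
    · refine Eventually.of_forall fun z => ?_
      have : ContinuousAt (fun ε : ℝ => Real.exp (ε * z) * h z) 0 := by fun_prop
      have h3 := this.tendsto
      simp only [zero_mul, Real.exp_zero, one_mul] at h3
      exact h3.mono_left nhdsWithin_le_nhds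
  have hsum : l + ∫ z in Ioi (0:ℝ), h z = T := by
    refine tendsto_nhds_unique ((h1.add h2).congr' ?_) hT
    have : Iio d ∈ 𝓝[>] (0:ℝ) := nhdsWithin_le_nhds (Iio_mem_nhds hd)
    filter_upwards [this, self_mem_nhdsWithin] with ε hε hε0
    have hi := exp_int h K C d ε hh hK hC hε0 hε
    have e1 : ∫ y in Ioi (0:ℝ), Real.exp (-ε * y) * h (-y) = ∫ z in Iic (0:ℝ), Real.exp (ε * z) * h z := by
      have := integral_comp_neg_Ioi (0:ℝ) (fun z => Real.exp (ε * z) * h z)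
      rw [neg_zero] at this
      rw [← this]
      congr 1
      ext y
      ring_nf
    rw [e1, ← setIntegral_union (Iic_disjoint_Ioi le_rfl) measurableSet_Ioi hi.integrableOn
      hi.integrableOn, Iic_union_Ioi, setIntegral_univ]
  rw [← hsum]
  have h3 := intervalIntegral_tendsto_integral_Ioi 0 hhi (tendsto_id (α := ℝ) (x := atTop))
  refine (hl.add h3).congr fun R => ?_
  have hi : ∀ u v, IntervalIntegrable h volume u v := fun u v => hh.intervalIntegrable u v
  rw [← intervalIntegral.integral_add_adjacent_intervals (hi (-R) 0) (hi 0 R),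
    intervalIntegral.integral_comp_neg h]
  simp

open Complex in
/-- Fourier-side kernel. -/
noncomputable def Phi (c s η v : ℝ) : ℂ :=
  cexp (I * (c ^ 3 * ((2 * Real.pi * v : ℝ) + η * I) ^ 3 / 3
        + s * ((2 * Real.pi * v : ℝ) + η * I)))

lemma continuous_Phi (c s η : ℝ) : Continuous (Phi c s η) := by
  unfold Phi; fun_prop

lemma integrable_Phi (c s η : ℝ) (hc : 0 < c) (hη : 0 < η) : Integrable (Phi c s η) := by
  have hpi := Real.pi_pos
  have h := (integrable_P (s / c) (c * η) (by positivity)).comp_mul_left'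
    (R := c * (2 * Real.pi)) (by positivity)
  refine h.congr (Eventually.of_forall fun v => ?_)
  have hcc : (c : ℂ) ≠ 0 := by exact_mod_cast hc.ne'
  simp only [P, Phi]
  congr 1
  push_cast
  field_simp

open FourierTransform in
lemma fourierInv_Phi (Ai : ℝ → ℝ)
    (hAi : ∀ x : ℝ, Tendsto
      (fun R : ℝ => (1 / Real.pi) * ∫ t in (0:ℝ)..R, Real.cos (t ^ 3 / 3 + x * t))
      atTop (nhds (Ai x))) (c s η z : ℝ) (hc : 0 < c) (hη : 0 < η) :
    𝓕⁻ (Phi c s η) z = ((Real.exp (η * z) * (1 / c * Ai ((z + s) / c)) : ℝ) : ℂ) := by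
  rw [Complex.ofReal_mul, Ai_scaled Ai hAi (z + s) η c hη hc, Real.fourierInv_eq',
    ← integral_const_mul]
  congr 1
  ext v
  rw [smul_eq_mul, Phi, Complex.ofReal_exp, ← Complex.exp_add, ← Complex.exp_add]
  congr 1
  have : inner ℝ v z = v * z := by simp [mul_comm]
  rw [this]
  push_cast
  linear_combination (-(η : ℂ) * z) * Complex.I_sq

open FourierTransform in
lemma parseval (Ai : ℝ → ℝ)
    (hAi : ∀ x : ℝ, Tendsto
      (fun R : ℝ => (1 / Real.pi) * ∫ t in (0:ℝ)..R, Real.cos (t ^ 3 / 3 + x * t))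
      atTop (nhds (Ai x))) (a b α β η : ℝ) (hα : 0 < α) (hβ : 0 < β) (hη : 0 < η)
    (hint : Integrable (fun z => Real.exp (η * z) * (1 / β * Ai ((z + b) / β)))) :
    ((∫ z, Real.exp (2 * η * z) * ((1 / α * Ai ((z + a) / α)) * (1 / β * Ai ((z + b) / β))) : ℝ) : ℂ)
      = ∫ v, Phi α a η (-v) * Phi β b η v := by
  have hk : Integrable (𝓕⁻ (Phi β b η)) := by
    rw [show 𝓕⁻ (Phi β b η) = _ from funext fun z => fourierInv_Phi Ai hAi β b η z hβ hη]
    exact hint.ofReal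
  have hk2 : Integrable (𝓕 (Phi β b η)) := by
    refine hk.comp_neg.congr (Eventually.of_forall fun z => ?_)
    simp only [Real.fourierInv_eq_fourier_neg, neg_neg]
  have inv := Continuous.fourier_fourierInv_eq (continuous_Phi β b η) (integrable_Phi β b η hβ hη) hk2
  have hf : Integrable (fun v => Phi α a η (-v)) := (integrable_Phi α a η hα hη).comp_neg
  have key : ∫ z, 𝓕 (fun v => Phi α a η (-v)) z * 𝓕⁻ (Phi β b η) z
      = ∫ v, Phi α a η (-v) * 𝓕 (𝓕⁻ (Phi β b η)) v := by
    have := VectorFourier.integral_fourierIntegral_smul_eq_flip (L := innerₗ ℝ)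
      (μ := volume) (ν := volume)
      Real.continuous_fourierChar continuous_inner hf hk
    simpa using! this
  rw [inv, ← Real.fourierInv_eq_fourier_comp_neg] at key
  rw [← key, ← integral_complex_ofReal]
  congr 1
  ext z
  rw [fourierInv_Phi Ai hAi α a η z hα hη, fourierInv_Phi Ai hAi β b η z hβ hη,
    ← Complex.ofReal_mul]
  congr 1
  rw [show 2 * η * z = η * z + η * z by ring, Real.exp_add]
  ring

lemma product_Phi (a b α β η c v : ℝ) (hc : 0 < c) (hγ : c ^ 3 = β ^ 3 - α ^ 3) :
    Phi α a η (-v) * Phi β b η v =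
      Real.exp ((α ^ 3 + β ^ 3) * η ^ 3 / 3 - (a + b) * η
        - (c ^ 3 * ((α ^ 3 + β ^ 3) * η / c ^ 3) ^ 3 / 3
          - ((b - a) - c ^ 3 * η ^ 2 + c ^ 3 * ((α ^ 3 + β ^ 3) * η / c ^ 3) ^ 2)
            * ((α ^ 3 + β ^ 3) * η / c ^ 3)))
      * Phi c ((b - a) - c ^ 3 * η ^ 2 + c ^ 3 * ((α ^ 3 + β ^ 3) * η / c ^ 3) ^ 2)
          ((α ^ 3 + β ^ 3) * η / c ^ 3) v := by
  obtain ⟨θ, hθ⟩ : ∃ θ, θ = (α ^ 3 + β ^ 3) * η / c ^ 3 := ⟨_, rfl⟩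
  have hθ' : c ^ 3 * θ = (α ^ 3 + β ^ 3) * η := by rw [hθ]; field_simp
  rw [← hθ]
  simp only [Phi]
  rw [Complex.ofReal_exp, ← Complex.exp_add, ← Complex.exp_add]
  congr 1
  have h1 : (c : ℂ) ^ 3 = β ^ 3 - α ^ 3 := by exact_mod_cast hγ
  have h2 : ((β : ℂ) ^ 3 - α ^ 3) * θ = (α ^ 3 + β ^ 3) * η := by
    rw [← h1]; exact_mod_cast hθ'
  push_cast
  rw [h1]
  obtain ⟨t, ht⟩ : ∃ t : ℂ, t = 2 * Real.pi * v := ⟨_, rfl⟩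
  rw [show (2 * Real.pi * -v : ℂ) = -t by rw [ht]; ring, ← ht]
  have e2 : (Complex.I : ℂ) ^ 2 = -1 := Complex.I_sq
  have e3 : (Complex.I : ℂ) ^ 3 = -Complex.I := by rw [pow_succ, e2]; ring
  have e4 : (Complex.I : ℂ) ^ 4 = 1 := by rw [show 4 = 2 * 2 from rfl, pow_mul, e2]; ring
  ring_nf
  simp only [e2, e3, e4]
  linear_combination (t ^ 2) * h2

lemma airy_lt (Ai : ℝ → ℝ)
    (hAi : ∀ x : ℝ, Tendsto
      (fun R : ℝ => (1 / Real.pi) * ∫ t in (0:ℝ)..R, Real.cos (t ^ 3 / 3 + x * t))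
      atTop (nhds (Ai x)))
    (a b α β c : ℝ) (hα : 0 < α) (hαβ : α < β) (hc : 0 < c) (hγ : c ^ 3 = β ^ 3 - α ^ 3) :
    Tendsto
      (fun R : ℝ => (1 / (α * β)) * ∫ z in (-R)..R, Ai ((z + a) / α) * Ai ((z + b) / β))
      atTop (𝓝 (1 / c * Ai ((b - a) / c))) := by
  have hβ : 0 < β := hα.trans hαβ
  obtain ⟨D, C, hC0, hA, hD, hC⟩ := Ai_facts Ai hAi
  obtain ⟨K, hK0, hK, hDK⟩ := energy Ai D C hC0 hA hD hC
  obtain ⟨l, hl⟩ := conv_product Ai D K hK0 hA hD hK hDK a b α β hα hαβ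
  have hAc : Continuous Ai := continuous_iff_continuousAt.2 fun y => (hA y).continuousAt
  have hCs : ∀ s γ : ℝ, 0 < γ → ∀ z, |1 / γ * Ai ((z + s) / γ)| ≤
      (1 / γ * C * Real.exp (-s / γ)) * Real.exp (-(1 / γ) * z) := by
    intro s γ hγ z
    rw [abs_mul, abs_of_pos (by positivity), mul_assoc, mul_assoc, ← Real.exp_add]
    have e : -s / γ + -(1 / γ) * z = -((z + s) / γ) := by ring
    rw [e]
    gcongr
    exact hC _
  have hKs : ∀ s γ : ℝ, 0 < γ → ∀ z, |1 / γ * Ai ((z + s) / γ)| ≤ 1 / γ * K := by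
    intro s γ hγ z
    rw [abs_mul, abs_of_pos (by positivity)]
    gcongr
    exact hK _
  have main := assemble (fun z => (1 / α * Ai ((z + a) / α)) * (1 / β * Ai ((z + b) / β)))
    (1 / α * K * (1 / β * K))
    ((1 / α * C * Real.exp (-a / α)) * (1 / β * C * Real.exp (-b / β))) (1 / α + 1 / β)
    (1 / (α * β) * l) (1 / c * Ai ((b - a) / c)) (by fun_prop)
    (fun z => by
      rw [abs_mul]
      have := hKs a α hα z
      have := hKs b β hβ z
      gcongr)
    (fun z => by
      rw [abs_mul]
      refine (mul_le_mul (hCs a α hα z) (hCs b β hβ z) (abs_nonneg _) (by positivity)).trans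
        (le_of_eq ?_)
      rw [show -(1 / α + 1 / β) * z = -(1 / α) * z + -(1 / β) * z by ring, Real.exp_add]
      ring) (by positivity) ?_ ?_
  · refine main.congr fun R => ?_
    rw [← intervalIntegral.integral_const_mul]
    congr 1
    ext z
    field_simp
  · refine (hl.const_mul (1 / (α * β))).congr fun R => ?_
    rw [← intervalIntegral.integral_const_mul]
    congr 1
    ext z
    field_simp
  · have hcont : Continuous (fun ε : ℝ =>
        Real.exp ((α ^ 3 + β ^ 3) * (ε / 2) ^ 3 / 3 - (a + b) * (ε / 2)
        - (c ^ 3 * ((α ^ 3 + β ^ 3) * (ε / 2) / c ^ 3) ^ 3 / 3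
          - ((b - a) - c ^ 3 * (ε / 2) ^ 2 + c ^ 3 * ((α ^ 3 + β ^ 3) * (ε / 2) / c ^ 3) ^ 2)
            * ((α ^ 3 + β ^ 3) * (ε / 2) / c ^ 3)))
        * (1 / c * Ai (((b - a) - c ^ 3 * (ε / 2) ^ 2
          + c ^ 3 * ((α ^ 3 + β ^ 3) * (ε / 2) / c ^ 3) ^ 2) / c))) := by fun_prop
    have h0 := (hcont.tendsto 0).mono_left (nhdsWithin_le_nhds (s := Ioi (0:ℝ)))
    have e0 : ∀ x : ℝ, x = 0 → Real.exp x = 1 := by rintro _ rfl; exact Real.exp_zero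
    beta_reduce at h0
    rw [e0 _ (by ring), one_mul] at h0
    have e1 : (b - a) - c ^ 3 * ((0:ℝ) / 2) ^ 2
          + c ^ 3 * ((α ^ 3 + β ^ 3) * (0 / 2) / c ^ 3) ^ 2 = b - a := by ring
    rw [e1] at h0
    refine h0.congr' ?_
    have : Iio (2 / β) ∈ 𝓝[>] (0:ℝ) := nhdsWithin_le_nhds (Iio_mem_nhds (by positivity))
    filter_upwards [this, self_mem_nhdsWithin] with ε hε hε0
    have hε : ε < 2 / β := hε
    have hε0 : 0 < ε := hε0
    have hε2 : ε / 2 < 1 / β := by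
      have : 2 / β = 2 * (1 / β) := by ring
      linarith
    have hp := parseval Ai hAi a b α β (ε / 2) hα hβ (by positivity)
      (exp_int _ _ _ (1 / β) (ε / 2) (by fun_prop) (hKs b β hβ) (hCs b β hβ) (by positivity) hε2)
    simp only [product_Phi a b α β (ε / 2) c _ hc hγ] at hp
    rw [integral_const_mul] at hp
    have hs := Ai_scaled Ai hAi ((b - a) - c ^ 3 * (ε / 2) ^ 2
          + c ^ 3 * ((α ^ 3 + β ^ 3) * (ε / 2) / c ^ 3) ^ 2)
          ((α ^ 3 + β ^ 3) * (ε / 2) / c ^ 3) c (by positivity) hc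
    simp only [Phi] at hp
    rw [← hs, ← Complex.ofReal_mul] at hp
    have hp' := Complex.ofReal_injective hp
    rw [show 2 * (ε / 2) = ε by ring] at hp'
    exact hp'.symm

end AiryProof

theorem stmt13 (Ai : ℝ → ℝ)
    (hAi : ∀ x : ℝ, Tendsto
      (fun R : ℝ => (1 / Real.pi) * ∫ t in (0:ℝ)..R, Real.cos (t ^ 3 / 3 + x * t))
      atTop (nhds (Ai x)))
    (a b α β : ℝ) (hα : 0 < α) (hβ : 0 < β) (hne : β ≠ α) :
    Tendsto
      (fun R : ℝ => (1 / (α * β)) * ∫ z in (-R)..R, Ai ((z + a) / α) * Ai ((z + b) / β))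
      atTop
      (nhds (|β ^ 3 - α ^ 3| ^ (-(1 / 3 : ℝ))
        * Ai ((b - a) / (Real.sign (β ^ 3 - α ^ 3) * |β ^ 3 - α ^ 3| ^ ((1 : ℝ) / 3))))) := by
  have hroot : ∀ g : ℝ, 0 < g → 0 < g ^ ((1 : ℝ) / 3) ∧ (g ^ ((1 : ℝ) / 3)) ^ 3 = g ∧
      g ^ (-(1 / 3 : ℝ)) = 1 / g ^ ((1 : ℝ) / 3) := by
    intro g hg
    refine ⟨by positivity, ?_, ?_⟩
    · rw [← Real.rpow_natCast, ← Real.rpow_mul hg.le]; norm_num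
    · rw [Real.rpow_neg hg.le, inv_eq_one_div]
  rcases lt_or_gt_of_ne hne with h | h
  · have hg : 0 < α ^ 3 - β ^ 3 := sub_pos.2 (by gcongr)
    obtain ⟨h1, h2, h3⟩ := hroot _ hg
    rw [abs_sub_comm, abs_of_pos hg, Real.sign_of_neg (by linarith), h3]
    have := AiryProof.airy_lt Ai hAi b a β α _ hβ h h1 h2
    have e : (b - a) / (-1 * (α ^ 3 - β ^ 3) ^ ((1 : ℝ) / 3))
        = (a - b) / (α ^ 3 - β ^ 3) ^ ((1 : ℝ) / 3) := by
      rw [neg_one_mul, div_neg, ← neg_div, neg_sub]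
    rw [e]
    refine this.congr fun R => ?_
    rw [mul_comm β α]
    congr 2
    ext z
    ring
  · have hg : 0 < β ^ 3 - α ^ 3 := sub_pos.2 (by gcongr)
    obtain ⟨h1, h2, h3⟩ := hroot _ hg
    rw [abs_of_pos hg, Real.sign_of_pos hg, h3, one_mul]
    exact AiryProof.airy_lt Ai hAi a b α β _ hα h h1 h2
end
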